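/- Let A = C[x] ⊗ Λ[ξ1,ξ2,ξ3,ξ4] with x even and ξ_i odd, and define the Lagrange–Jacobi bracket {f,g} = f·∂_x g - (-1)^{|f||g|} g·∂_x f + (-1)^{|f|}·(1/2)·Σ_{j=1}^{4} (D_{ξ_j}f)(D_{ξ_j}g), where D_{ξ_j} = ∂_{ξ_j} + ξ_j ∂_x. Fix ε ∈ C and let ν = ξ1ξ2ξ3ξ4 and ξ_i^∨ = ∂_{ξ_i}ν. Then the (9|8)-dimensional subspace g ⊆ A spanned by 1; ξ1,...,ξ4; x; the six products ξ_iξ_j (i<j); the four elements x·ξ_i + ε·ξ_i^∨; and (1/2)x^2 - ε·ν, is closed under the bracket {·,·}. -/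

import Mathlib

/-!
Statement 18: In A = ℂ[x] ⊗ Λ[ξ1,ξ2,ξ3,ξ4] with the Lagrange–Jacobi bracket
{f,g} = f·∂ₓg - (-1)^{|f||g|}g·∂ₓf + (-1)^{|f|}·(1/2)·Σⱼ (D_{ξⱼ}f)(D_{ξⱼ}g),
D_{ξⱼ} = ∂_{ξⱼ} + ξⱼ∂ₓ, the (9|8)-dimensional subspace spanned by
1; ξ₁,…,ξ₄; x; ξᵢξⱼ; x·ξᵢ + ε·ξᵢ^∨; (1/2)x² - ε·ν (with ν = ξ₁ξ₂ξ₃ξ₄ and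
ξᵢ^∨ = ∂_{ξᵢ}ν) is closed under the bracket.

A is realized as functions Finset (Fin 4) → ℂ[x]: an element f assigns to each
set S of odd indices the polynomial coefficient of the monomial ξ_S (indices in
increasing order).  The supercommutative product carries the Koszul reordering
sign; the bracket formula, involving the parities |f|,|g|, applies to
parity-homogeneous elements.
-/

namespace Stmt18

noncomputable section

open Finset Polynomial

abbrev A := Finset (Fin 4) → Polynomial ℂ

/-- Koszul sign for reordering ξ_S · ξ_T into ξ_{S∪T} (S, T disjoint):
(-1)^(number of inversions). -/
def ksgn (S T : Finset (Fin 4)) : ℂ :=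
  (-1 : ℂ) ^ (((S ×ˢ T).filter fun p => p.2 < p.1).card)

/-- the supercommutative product of A -/
def amul (f g : A) : A := fun U =>
  ∑ S ∈ U.powerset, ksgn S (U \ S) • (f S * g (U \ S))

/-- the even derivative ∂ₓ -/
def dx (f : A) : A := fun S => derivative (f S)

/-- the odd derivative ∂_{ξⱼ} -/
def dxi (j : Fin 4) (f : A) : A := fun S =>
  if j ∈ S then 0
  else ((-1 : ℂ) ^ ((S.filter fun i => i < j).card)) • f (insert j S)

/-- the generator ξⱼ as an element of A -/
def gen (j : Fin 4) : A := fun S => if S = {j} then 1 else 0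

/-- D_{ξⱼ} = ∂_{ξⱼ} + ξⱼ·∂ₓ -/
def Dop (j : Fin 4) (f : A) : A := dxi j f + amul (gen j) (dx f)

/-- the Lagrange–Jacobi bracket of elements of parities pf, pg -/
def jb (pf pg : ℕ) (f g : A) : A :=
  amul f (dx g) - ((-1 : ℂ) ^ (pf * pg)) • amul g (dx f)
    + (((-1 : ℂ) ^ pf) * (1/2)) • ∑ j : Fin 4, amul (Dop j f) (Dop j g)

/-- parity-homogeneity of parity p -/
def homog (p : ℕ) (f : A) : Prop := ∀ S, f S ≠ 0 → S.card % 2 = p % 2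

def oneA : A := fun S => if S = ∅ then 1 else 0
def xA : A := fun S => if S = ∅ then Polynomial.X else 0
def x2A : A := fun S => if S = ∅ then Polynomial.X ^ 2 else 0
/-- ν = ξ₁ξ₂ξ₃ξ₄ -/
def nu : A := fun S => if S = Finset.univ then 1 else 0

/-- the (9|8)-dimensional subspace g ≅ D(2,1;a), a = (1-ε)/(1+ε) -/
def gSub (ε : ℂ) : Submodule ℂ A :=
  Submodule.span ℂ
    ({oneA, xA} ∪ Set.range gen
      ∪ {m | ∃ i j : Fin 4, m = amul (gen i) (gen j)}
      ∪ {m | ∃ i : Fin 4, m = amul xA (gen i) + ε • dxi i nu}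
      ∪ {(1/2 : ℂ) • x2A - ε • nu})

/-- The element of `A` whose coefficients, ordered by degree and then lexicographically,
are listed by `p`. -/
def ofCoeffs (p : Fin 16 → ℂ[X]) : A := fun S =>
  if 0 ∈ S then
    if 1 ∈ S then
      if 2 ∈ S then if 3 ∈ S then p 15 else p 11 else if 3 ∈ S then p 12 else p 5
    else if 2 ∈ S then if 3 ∈ S then p 13 else p 6 else if 3 ∈ S then p 7 else p 1
  else
    if 1 ∈ S then
      if 2 ∈ S then if 3 ∈ S then p 14 else p 8 else if 3 ∈ S then p 9 else p 2
    else if 2 ∈ S then if 3 ∈ S then p 10 else p 3 else if 3 ∈ S then p 4 else p 0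

theorem eq_of_apply_eq {f g : A}
    (h_empty : f ∅ = g ∅) (h0 : f {0} = g {0}) (h1 : f {1} = g {1}) (h2 : f {2} = g {2})
    (h3 : f {3} = g {3}) (h01 : f {0, 1} = g {0, 1}) (h02 : f {0, 2} = g {0, 2})
    (h03 : f {0, 3} = g {0, 3}) (h12 : f {1, 2} = g {1, 2}) (h13 : f {1, 3} = g {1, 3})
    (h23 : f {2, 3} = g {2, 3}) (h012 : f {0, 1, 2} = g {0, 1, 2})
    (h013 : f {0, 1, 3} = g {0, 1, 3}) (h023 : f {0, 2, 3} = g {0, 2, 3})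
    (h123 : f {1, 2, 3} = g {1, 2, 3}) (h0123 : f {0, 1, 2, 3} = g {0, 1, 2, 3}) :
    f = g := by
  have key : ∀ S : Finset (Fin 4),
      S = ∅ ∨ S = {0} ∨ S = {1} ∨ S = {2} ∨ S = {3} ∨ S = {0, 1} ∨ S = {0, 2} ∨ S = {0, 3} ∨
      S = {1, 2} ∨ S = {1, 3} ∨ S = {2, 3} ∨ S = {0, 1, 2} ∨ S = {0, 1, 3} ∨ S = {0, 2, 3} ∨
      S = {1, 2, 3} ∨ S = {0, 1, 2, 3} := by
    decide
  funext S
  rcases key S with rfl | rfl | rfl | rfl | rfl | rfl | rfl | rfl | rfl | rfl | rfl | rfl | rfl |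
    rfl | rfl | rfl <;> assumption

theorem ksgn_eq_intCast (S T : Finset (Fin 4)) :
    ksgn S T = (((-1 : ℤ) ^ ((S ×ˢ T).filter fun p => p.2 < p.1).card : ℤ) : ℂ) := by
  simp [ksgn]

/-- Evaluation of a product from an explicit list of the splittings of `U` and their signs. -/
theorem amul_apply_of_splittings (U : Finset (Fin 4))
    (l : List (Finset (Fin 4) × Finset (Fin 4) × ℤ))
    (h : (U.powerset.val.map fun S =>
      (S, U \ S, (-1 : ℤ) ^ ((S ×ˢ (U \ S)).filter fun p => p.2 < p.1).card)) = l) (f g : A) :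
    amul f g U = (l.map fun p => (p.2.2 : ℂ[X]) * (f p.1 * g p.2.1)).sum := by
  rw [← Multiset.sum_coe, ← Multiset.map_coe, ← h, Multiset.map_map]
  refine congrArg Multiset.sum (Multiset.map_congr rfl fun S _ => ?_)
  rw [ksgn_eq_intCast, smul_eq_C_mul, map_intCast]
  rfl

set_option maxHeartbeats 2000000 in
theorem amul_ofCoeffs (p q : Fin 16 → ℂ[X]) :
    amul (ofCoeffs p) (ofCoeffs q) = ofCoeffs ![
      p 0 * q 0,
      p 0 * q 1 + p 1 * q 0,
      p 0 * q 2 + p 2 * q 0,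
      p 0 * q 3 + p 3 * q 0,
      p 0 * q 4 + p 4 * q 0,
      p 0 * q 5 + p 1 * q 2 - p 2 * q 1 + p 5 * q 0,
      p 0 * q 6 + p 1 * q 3 - p 3 * q 1 + p 6 * q 0,
      p 0 * q 7 + p 1 * q 4 - p 4 * q 1 + p 7 * q 0,
      p 0 * q 8 + p 2 * q 3 - p 3 * q 2 + p 8 * q 0,
      p 0 * q 9 + p 2 * q 4 - p 4 * q 2 + p 9 * q 0,
      p 0 * q 10 + p 3 * q 4 - p 4 * q 3 + p 10 * q 0,
      p 0 * q 11 + p 1 * q 8 - p 2 * q 6 + p 3 * q 5 + p 5 * q 3 - p 6 * q 2 + p 8 * q 1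
      + p 11 * q 0,
      p 0 * q 12 + p 1 * q 9 - p 2 * q 7 + p 4 * q 5 + p 5 * q 4 - p 7 * q 2 + p 9 * q 1
      + p 12 * q 0,
      p 0 * q 13 + p 1 * q 10 - p 3 * q 7 + p 4 * q 6 + p 6 * q 4 - p 7 * q 3 + p 10 * q 1
      + p 13 * q 0,
      p 0 * q 14 + p 2 * q 10 - p 3 * q 9 + p 4 * q 8 + p 8 * q 4 - p 9 * q 3 + p 10 * q 2
      + p 14 * q 0,
      p 0 * q 15 + p 1 * q 14 - p 2 * q 13 + p 3 * q 12 - p 4 * q 11 + p 5 * q 10 - p 6 * q 9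
      + p 7 * q 8 + p 8 * q 7 - p 9 * q 6 + p 10 * q 5 + p 11 * q 4 - p 12 * q 3 + p 13 * q 2
      - p 14 * q 1 + p 15 * q 0] := by
  apply eq_of_apply_eq
  · rw [amul_apply_of_splittings ∅ [
      (∅, ∅, 1)] (by decide)]
    simp [ofCoeffs, sub_eq_add_neg, add_assoc]
  · rw [amul_apply_of_splittings {0} [
      (∅, {0}, 1), ({0}, ∅, 1)] (by decide)]
    simp [ofCoeffs, sub_eq_add_neg, add_assoc]
  · rw [amul_apply_of_splittings {1} [
      (∅, {1}, 1), ({1}, ∅, 1)] (by decide)]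
    simp [ofCoeffs, sub_eq_add_neg, add_assoc]
  · rw [amul_apply_of_splittings {2} [
      (∅, {2}, 1), ({2}, ∅, 1)] (by decide)]
    simp [ofCoeffs, sub_eq_add_neg, add_assoc]
  · rw [amul_apply_of_splittings {3} [
      (∅, {3}, 1), ({3}, ∅, 1)] (by decide)]
    simp [ofCoeffs, sub_eq_add_neg, add_assoc]
  · rw [amul_apply_of_splittings {0, 1} [
      (∅, {0, 1}, 1), ({0}, {1}, 1), ({1}, {0}, -1), ({0, 1}, ∅, 1)] (by decide)]
    simp [ofCoeffs, sub_eq_add_neg, add_assoc]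
  · rw [amul_apply_of_splittings {0, 2} [
      (∅, {0, 2}, 1), ({0}, {2}, 1), ({2}, {0}, -1), ({0, 2}, ∅, 1)] (by decide)]
    simp [ofCoeffs, sub_eq_add_neg, add_assoc]
  · rw [amul_apply_of_splittings {0, 3} [
      (∅, {0, 3}, 1), ({0}, {3}, 1), ({3}, {0}, -1), ({0, 3}, ∅, 1)] (by decide)]
    simp [ofCoeffs, sub_eq_add_neg, add_assoc]
  · rw [amul_apply_of_splittings {1, 2} [
      (∅, {1, 2}, 1), ({1}, {2}, 1), ({2}, {1}, -1), ({1, 2}, ∅, 1)] (by decide)]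
    simp [ofCoeffs, sub_eq_add_neg, add_assoc]
  · rw [amul_apply_of_splittings {1, 3} [
      (∅, {1, 3}, 1), ({1}, {3}, 1), ({3}, {1}, -1), ({1, 3}, ∅, 1)] (by decide)]
    simp [ofCoeffs, sub_eq_add_neg, add_assoc]
  · rw [amul_apply_of_splittings {2, 3} [
      (∅, {2, 3}, 1), ({2}, {3}, 1), ({3}, {2}, -1), ({2, 3}, ∅, 1)] (by decide)]
    simp [ofCoeffs, sub_eq_add_neg, add_assoc]
  · rw [amul_apply_of_splittings {0, 1, 2} [
      (∅, {0, 1, 2}, 1), ({0}, {1, 2}, 1), ({1}, {0, 2}, -1), ({2}, {0, 1}, 1), ({0, 1}, {2}, 1),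
      ({0, 2}, {1}, -1), ({1, 2}, {0}, 1), ({0, 1, 2}, ∅, 1)] (by decide)]
    simp [ofCoeffs, sub_eq_add_neg, add_assoc]
  · rw [amul_apply_of_splittings {0, 1, 3} [
      (∅, {0, 1, 3}, 1), ({0}, {1, 3}, 1), ({1}, {0, 3}, -1), ({3}, {0, 1}, 1), ({0, 1}, {3}, 1),
      ({0, 3}, {1}, -1), ({1, 3}, {0}, 1), ({0, 1, 3}, ∅, 1)] (by decide)]
    simp [ofCoeffs, sub_eq_add_neg, add_assoc]
  · rw [amul_apply_of_splittings {0, 2, 3} [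
      (∅, {0, 2, 3}, 1), ({0}, {2, 3}, 1), ({2}, {0, 3}, -1), ({3}, {0, 2}, 1), ({0, 2}, {3}, 1),
      ({0, 3}, {2}, -1), ({2, 3}, {0}, 1), ({0, 2, 3}, ∅, 1)] (by decide)]
    simp [ofCoeffs, sub_eq_add_neg, add_assoc]
  · rw [amul_apply_of_splittings {1, 2, 3} [
      (∅, {1, 2, 3}, 1), ({1}, {2, 3}, 1), ({2}, {1, 3}, -1), ({3}, {1, 2}, 1), ({1, 2}, {3}, 1),
      ({1, 3}, {2}, -1), ({2, 3}, {1}, 1), ({1, 2, 3}, ∅, 1)] (by decide)]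
    simp [ofCoeffs, sub_eq_add_neg, add_assoc]
  · rw [amul_apply_of_splittings {0, 1, 2, 3} [
      (∅, {0, 1, 2, 3}, 1), ({0}, {1, 2, 3}, 1), ({1}, {0, 2, 3}, -1), ({2}, {0, 1, 3}, 1),
      ({3}, {0, 1, 2}, -1), ({0, 1}, {2, 3}, 1), ({0, 2}, {1, 3}, -1), ({0, 3}, {1, 2}, 1),
      ({1, 2}, {0, 3}, 1), ({1, 3}, {0, 2}, -1), ({2, 3}, {0, 1}, 1), ({0, 1, 2}, {3}, 1),
      ({0, 1, 3}, {2}, -1), ({0, 2, 3}, {1}, 1), ({1, 2, 3}, {0}, -1),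
      ({0, 1, 2, 3}, ∅, 1)] (by decide)]
    simp [ofCoeffs, sub_eq_add_neg, add_assoc]

theorem dx_ofCoeffs (p : Fin 16 → ℂ[X]) :
    dx (ofCoeffs p) = ofCoeffs fun i => derivative (p i) := by
  funext S
  simp only [dx, ofCoeffs, apply_ite derivative]

theorem gen_0_eq_ofCoeffs :
    gen 0 = ofCoeffs ![0, 1, 0, 0, 0, 0, 0, 0, 0, 0, 0, 0, 0, 0, 0, 0] := by
  apply eq_of_apply_eq <;> simp [gen, ofCoeffs] <;> decide

theorem dxi_0_ofCoeffs (p : Fin 16 → ℂ[X]) :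
    dxi 0 (ofCoeffs p) = ofCoeffs ![
      p 1, 0, p 5, p 6, p 7, 0, 0, 0, p 11, p 12, p 13, 0, 0, 0, p 15, 0] := by
  apply eq_of_apply_eq <;> simp [dxi, ofCoeffs, Finset.filter_insert, Finset.filter_singleton]

theorem Dop_0_ofCoeffs (p : Fin 16 → ℂ[X]) :
    Dop 0 (ofCoeffs p) = ofCoeffs ![
      p 1, derivative (p 0), p 5, p 6, p 7, derivative (p 2), derivative (p 3), derivative (p 4),
      p 11, p 12, p 13, derivative (p 8), derivative (p 9), derivative (p 10), p 15,
      derivative (p 14)] := by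
  rw [Dop, dxi_0_ofCoeffs, gen_0_eq_ofCoeffs, dx_ofCoeffs, amul_ofCoeffs]
  apply eq_of_apply_eq <;> simp [ofCoeffs]

theorem gen_1_eq_ofCoeffs :
    gen 1 = ofCoeffs ![0, 0, 1, 0, 0, 0, 0, 0, 0, 0, 0, 0, 0, 0, 0, 0] := by
  apply eq_of_apply_eq <;> simp [gen, ofCoeffs] <;> decide

theorem dxi_1_ofCoeffs (p : Fin 16 → ℂ[X]) :
    dxi 1 (ofCoeffs p) = ofCoeffs ![
      p 2, -p 5, 0, p 8, p 9, 0, -p 11, -p 12, 0, 0, p 14, 0, 0, -p 15, 0, 0] := by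
  apply eq_of_apply_eq <;> simp [dxi, ofCoeffs, Finset.filter_insert, Finset.filter_singleton]

theorem Dop_1_ofCoeffs (p : Fin 16 → ℂ[X]) :
    Dop 1 (ofCoeffs p) = ofCoeffs ![
      p 2, -p 5, derivative (p 0), p 8, p 9, -derivative (p 1), -p 11, -p 12, derivative (p 3),
      derivative (p 4), p 14, -derivative (p 6), -derivative (p 7), -p 15, derivative (p 10),
      -derivative (p 13)] := by
  rw [Dop, dxi_1_ofCoeffs, gen_1_eq_ofCoeffs, dx_ofCoeffs, amul_ofCoeffs]
  apply eq_of_apply_eq <;> simp [ofCoeffs]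

theorem gen_2_eq_ofCoeffs :
    gen 2 = ofCoeffs ![0, 0, 0, 1, 0, 0, 0, 0, 0, 0, 0, 0, 0, 0, 0, 0] := by
  apply eq_of_apply_eq <;> simp [gen, ofCoeffs] <;> decide

theorem dxi_2_ofCoeffs (p : Fin 16 → ℂ[X]) :
    dxi 2 (ofCoeffs p) = ofCoeffs ![
      p 3, -p 6, -p 8, 0, p 10, p 11, 0, -p 13, 0, -p 14, 0, 0, p 15, 0, 0, 0] := by
  apply eq_of_apply_eq <;> simp [dxi, ofCoeffs, Finset.filter_insert, Finset.filter_singleton]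

theorem Dop_2_ofCoeffs (p : Fin 16 → ℂ[X]) :
    Dop 2 (ofCoeffs p) = ofCoeffs ![
      p 3, -p 6, -p 8, derivative (p 0), p 10, p 11, -derivative (p 1), -p 13, -derivative (p 2),
      -p 14, derivative (p 4), derivative (p 5), p 15, -derivative (p 7), -derivative (p 9),
      derivative (p 12)] := by
  rw [Dop, dxi_2_ofCoeffs, gen_2_eq_ofCoeffs, dx_ofCoeffs, amul_ofCoeffs]
  apply eq_of_apply_eq <;> simp [ofCoeffs]

theorem gen_3_eq_ofCoeffs :
    gen 3 = ofCoeffs ![0, 0, 0, 0, 1, 0, 0, 0, 0, 0, 0, 0, 0, 0, 0, 0] := by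
  apply eq_of_apply_eq <;> simp [gen, ofCoeffs] <;> decide

theorem dxi_3_ofCoeffs (p : Fin 16 → ℂ[X]) :
    dxi 3 (ofCoeffs p) = ofCoeffs ![
      p 4, -p 7, -p 9, -p 10, 0, p 12, p 13, 0, p 14, 0, 0, -p 15, 0, 0, 0, 0] := by
  apply eq_of_apply_eq <;> simp [dxi, ofCoeffs, Finset.filter_insert, Finset.filter_singleton,
    pow_succ]

theorem Dop_3_ofCoeffs (p : Fin 16 → ℂ[X]) :
    Dop 3 (ofCoeffs p) = ofCoeffs ![
      p 4, -p 7, -p 9, -p 10, derivative (p 0), p 12, p 13, -derivative (p 1), p 14,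
      -derivative (p 2), -derivative (p 3), -p 15, derivative (p 5), derivative (p 6),
      derivative (p 8), -derivative (p 11)] := by
  rw [Dop, dxi_3_ofCoeffs, gen_3_eq_ofCoeffs, dx_ofCoeffs, amul_ofCoeffs]
  apply eq_of_apply_eq <;> simp [ofCoeffs]

/-- The general element of `gSub ε`: `a`, `b`, `c` are the coefficients of `1`, `x` and
`x² - 2 ε ν`, `r` those of the products `ξᵢ ξⱼ` with `i < j`, `s` those of the `ξᵢ`, and `t` those
of the `x ξᵢ + ε ξᵢ^∨`. -/
def elt (ε a b c : ℂ) (r : Fin 6 → ℂ) (s t : Fin 4 → ℂ) : A :=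
  ofCoeffs ![C a + C b * X + C c * X ^ 2,
    C (s 0) + C (t 0) * X, C (s 1) + C (t 1) * X, C (s 2) + C (t 2) * X, C (s 3) + C (t 3) * X,
    C (r 0), C (r 1), C (r 2), C (r 3), C (r 4), C (r 5),
    C (-ε * t 3), C (ε * t 2), C (-ε * t 1), C (ε * t 0), C (-2 * ε * c)]

theorem oneA_eq_ofCoeffs : oneA = ofCoeffs ![1, 0, 0, 0, 0, 0, 0, 0, 0, 0, 0, 0, 0, 0, 0, 0] := by
  apply eq_of_apply_eq <;> simp [oneA, ofCoeffs]

theorem xA_eq_ofCoeffs : xA = ofCoeffs ![X, 0, 0, 0, 0, 0, 0, 0, 0, 0, 0, 0, 0, 0, 0, 0] := by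
  apply eq_of_apply_eq <;> simp [xA, ofCoeffs]

theorem x2A_eq_ofCoeffs :
    x2A = ofCoeffs ![X ^ 2, 0, 0, 0, 0, 0, 0, 0, 0, 0, 0, 0, 0, 0, 0, 0] := by
  apply eq_of_apply_eq <;> simp [x2A, ofCoeffs]

theorem nu_eq_ofCoeffs : nu = ofCoeffs ![0, 0, 0, 0, 0, 0, 0, 0, 0, 0, 0, 0, 0, 0, 0, 1] := by
  apply eq_of_apply_eq <;> simp [nu, ofCoeffs] <;> decide

theorem ofCoeffs_add (p q : Fin 16 → ℂ[X]) : ofCoeffs p + ofCoeffs q = ofCoeffs (p + q) := by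
  apply eq_of_apply_eq <;> simp [ofCoeffs]

theorem ofCoeffs_sub (p q : Fin 16 → ℂ[X]) : ofCoeffs p - ofCoeffs q = ofCoeffs (p - q) := by
  apply eq_of_apply_eq <;> simp [ofCoeffs]

theorem neg_ofCoeffs (p : Fin 16 → ℂ[X]) : -ofCoeffs p = ofCoeffs (-p) := by
  apply eq_of_apply_eq <;> simp [ofCoeffs]

theorem smul_ofCoeffs (k : ℂ) (p : Fin 16 → ℂ[X]) : k • ofCoeffs p = ofCoeffs (k • p) := by
  apply eq_of_apply_eq <;> simp [ofCoeffs]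

theorem ofCoeffs_eq_of_eval {p q : Fin 16 → ℂ[X]}
    (h : ∀ (z : ℂ) (i : Fin 16), (p i).eval z = (q i).eval z) : ofCoeffs p = ofCoeffs q :=
  congrArg ofCoeffs (funext fun i => Polynomial.funext fun z => h z i)

theorem eq_elt_of_eval {ε a b c : ℂ} {r : Fin 6 → ℂ} {s t : Fin 4 → ℂ} {p : Fin 16 → ℂ[X]}
    (h : ∀ z : ℂ, (fun i => (p i).eval z) = ![a + b * z + c * z ^ 2,
      s 0 + t 0 * z, s 1 + t 1 * z, s 2 + t 2 * z, s 3 + t 3 * z,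
      r 0, r 1, r 2, r 3, r 4, r 5, -ε * t 3, ε * t 2, -ε * t 1, ε * t 0, -2 * ε * c]) :
    ofCoeffs p = elt ε a b c r s t := by
  refine ofCoeffs_eq_of_eval fun z i => ?_
  refine (congrFun (h z) i).trans ?_
  fin_cases i <;> simp

theorem elt_add (ε a b c a₂ b₂ c₂ : ℂ) (r r₂ : Fin 6 → ℂ) (s t s₂ t₂ : Fin 4 → ℂ) :
    elt ε a b c r s t + elt ε a₂ b₂ c₂ r₂ s₂ t₂ =
      elt ε (a + a₂) (b + b₂) (c + c₂) (r + r₂) (s + s₂) (t + t₂) := by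
  rw [elt, elt, ofCoeffs_add]
  refine eq_elt_of_eval fun z => funext fun i => ?_
  fin_cases i <;> simp <;> ring

theorem smul_elt (k ε a b c : ℂ) (r : Fin 6 → ℂ) (s t : Fin 4 → ℂ) :
    k • elt ε a b c r s t = elt ε (k * a) (k * b) (k * c) (k • r) (k • s) (k • t) := by
  rw [elt, smul_ofCoeffs]
  refine eq_elt_of_eval fun z => funext fun i => ?_
  fin_cases i <;> simp <;> ring

theorem elt_eq_sum (ε a b c : ℂ) (r : Fin 6 → ℂ) (s t : Fin 4 → ℂ) :
    elt ε a b c r s t = a • oneA + b • xA + (2 * c) • ((1 / 2 : ℂ) • x2A - ε • nu)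
      + ∑ i, s i • gen i + ∑ i, t i • (amul xA (gen i) + ε • dxi i nu)
      + (r 0 • amul (gen 0) (gen 1) + r 1 • amul (gen 0) (gen 2) + r 2 • amul (gen 0) (gen 3)
        + r 3 • amul (gen 1) (gen 2) + r 4 • amul (gen 1) (gen 3)
        + r 5 • amul (gen 2) (gen 3)) := by
  simp [elt, Fin.sum_univ_four, oneA_eq_ofCoeffs, xA_eq_ofCoeffs, x2A_eq_ofCoeffs, nu_eq_ofCoeffs,
    gen_0_eq_ofCoeffs, gen_1_eq_ofCoeffs, gen_2_eq_ofCoeffs, gen_3_eq_ofCoeffs,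
    dxi_0_ofCoeffs, dxi_1_ofCoeffs, dxi_2_ofCoeffs, dxi_3_ofCoeffs, amul_ofCoeffs,
    smul_ofCoeffs, ofCoeffs_add, ofCoeffs_sub, smul_eq_C_mul]
  refine ofCoeffs_eq_of_eval fun z i => ?_
  fin_cases i <;> simp <;> ring

theorem elt_mem_gSub (ε a b c : ℂ) (r : Fin 6 → ℂ) (s t : Fin 4 → ℂ) :
    elt ε a b c r s t ∈ gSub ε := by
  have h1 : oneA ∈ gSub ε := Submodule.subset_span (by simp)
  have hx : xA ∈ gSub ε := Submodule.subset_span (by simp)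
  have hq : (1 / 2 : ℂ) • x2A - ε • nu ∈ gSub ε := Submodule.subset_span (by simp)
  have hs (i : Fin 4) : gen i ∈ gSub ε := Submodule.subset_span (by simp)
  have ht (i : Fin 4) : amul xA (gen i) + ε • dxi i nu ∈ gSub ε :=
    Submodule.subset_span (Or.inl (Or.inr ⟨i, rfl⟩))
  have hr (i j : Fin 4) : amul (gen i) (gen j) ∈ gSub ε :=
    Submodule.subset_span (Or.inl (Or.inl (Or.inr ⟨i, j, rfl⟩)))
  rw [elt_eq_sum]
  refine add_mem (add_mem (add_mem (add_mem (add_mem ?_ ?_) ?_) ?_) ?_)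
    (add_mem (add_mem (add_mem (add_mem (add_mem ?_ ?_) ?_) ?_) ?_) ?_)
  case refine_4 => exact sum_mem fun i _ => Submodule.smul_mem _ _ (hs i)
  case refine_5 => exact sum_mem fun i _ => Submodule.smul_mem _ _ (ht i)
  all_goals apply Submodule.smul_mem
  all_goals first | exact h1 | exact hx | exact hq | apply hr

theorem amul_gen_self (i : Fin 4) : amul (gen i) (gen i) = 0 := by
  fin_cases i <;>
  simp [gen_0_eq_ofCoeffs, gen_1_eq_ofCoeffs, gen_2_eq_ofCoeffs, gen_3_eq_ofCoeffs,
    amul_ofCoeffs] <;>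
  apply eq_of_apply_eq <;> simp [ofCoeffs]

theorem amul_gen_swap {i j : Fin 4} (h : i < j) :
    amul (gen j) (gen i) = (-1 : ℂ) • amul (gen i) (gen j) := by
  fin_cases i <;> fin_cases j <;> (first | exact absurd h (by decide) | skip) <;>
  simp [gen_0_eq_ofCoeffs, gen_1_eq_ofCoeffs, gen_2_eq_ofCoeffs, gen_3_eq_ofCoeffs,
    amul_ofCoeffs] <;>
  apply eq_of_apply_eq <;> simp [ofCoeffs]

theorem exists_eq_elt_of_mem_gSub {ε : ℂ} {f : A} (hf : f ∈ gSub ε) :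
    ∃ a b c r s t, f = elt ε a b c r s t := by
  induction hf using Submodule.span_induction with
  | zero => exact ⟨0, 0, 0, 0, 0, 0, by simp [elt_eq_sum]⟩
  | add f g _ _ hf hg =>
    obtain ⟨a, b, c, r, s, t, rfl⟩ := hf
    obtain ⟨a₂, b₂, c₂, r₂, s₂, t₂, rfl⟩ := hg
    exact ⟨_, _, _, _, _, _, elt_add ..⟩
  | smul k f _ hf =>
    obtain ⟨a, b, c, r, s, t, rfl⟩ := hf
    exact ⟨_, _, _, _, _, _, smul_elt ..⟩
  | mem f hf =>
    obtain (((hf | ⟨i, rfl⟩) | ⟨i, j, rfl⟩) | ⟨i, rfl⟩) | hf := hf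
    · obtain rfl | hf := hf
      · exact ⟨1, 0, 0, 0, 0, 0, by simp [elt_eq_sum]⟩
      · obtain rfl := hf
        exact ⟨0, 1, 0, 0, 0, 0, by simp [elt_eq_sum]⟩
    · exact ⟨0, 0, 0, 0, Pi.single i 1, 0, by simp [elt_eq_sum, Pi.single_apply]⟩
    · have key : ∀ i j : Fin 4, i < j → ∃ r, amul (gen i) (gen j) = elt ε 0 0 0 r 0 0 := by
        intro i j hij
        simp only [elt_eq_sum]
        fin_cases i <;> fin_cases j <;> first | exact absurd hij (by decide) | skip
        · exact ⟨Pi.single 0 1, by simp⟩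
        · exact ⟨Pi.single 1 1, by simp⟩
        · exact ⟨Pi.single 2 1, by simp⟩
        · exact ⟨Pi.single 3 1, by simp⟩
        · exact ⟨Pi.single 4 1, by simp⟩
        · exact ⟨Pi.single 5 1, by simp⟩
      rcases lt_trichotomy i j with h | rfl | h
      · obtain ⟨r, hr⟩ := key i j h
        exact ⟨0, 0, 0, r, 0, 0, hr⟩
      · exact ⟨0, 0, 0, 0, 0, 0, by simp [elt_eq_sum, amul_gen_self]⟩
      · obtain ⟨r, hr⟩ := key j i h
        rw [amul_gen_swap h, hr]
        exact ⟨_, _, _, _, _, _, smul_elt ..⟩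
    · exact ⟨0, 0, 0, 0, 0, Pi.single i 1, by simp [elt_eq_sum, Pi.single_apply, -smul_add]⟩
    · obtain rfl := hf
      exact ⟨0, 0, 1 / 2, 0, 0, 0, by simp [elt_eq_sum]⟩

theorem eq_zero_of_C_add_C_mul_X {a b : ℂ} (h : C a + C b * X = 0) : a = 0 ∧ b = 0 := by
  have h0 := congrArg (coeff · 0) h
  have h1 := congrArg (coeff · 1) h
  simp [coeff_C] at h0 h1
  exact ⟨h0, h1⟩

theorem exists_eq_even_elt {ε : ℂ} {f : A} {p : ℕ} (hp : Even p) (hf : f ∈ gSub ε)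
    (h : homog p f) : ∃ a b c r, f = elt ε a b c r 0 0 := by
  obtain ⟨a, b, c, r, s, t, rfl⟩ := exists_eq_elt_of_mem_gSub hf
  have key (i : Fin 4) : s i = 0 ∧ t i = 0 := by
    have hi : elt ε a b c r s t {i} = 0 := by
      by_contra hne
      have := h _ hne
      rw [Nat.even_iff.1 hp] at this
      simp at this
    apply eq_zero_of_C_add_C_mul_X
    rw [← hi]
    fin_cases i <;> simp [elt, ofCoeffs]
  obtain rfl : s = 0 := funext fun i => (key i).1
  obtain rfl : t = 0 := funext fun i => (key i).2
  exact ⟨a, b, c, r, rfl⟩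

theorem exists_eq_odd_elt {ε : ℂ} {f : A} {p : ℕ} (hp : Odd p) (hf : f ∈ gSub ε)
    (h : homog p f) : ∃ s t, f = elt ε 0 0 0 0 s t := by
  obtain ⟨a, b, c, r, s, t, rfl⟩ := exists_eq_elt_of_mem_gSub hf
  have key (S : Finset (Fin 4)) (hS : S.card % 2 = 0) : elt ε a b c r s t S = 0 := by
    by_contra hne
    have := h _ hne
    rw [Nat.odd_iff.1 hp, hS] at this
    exact absurd this (by decide)
  have h0 := key ∅ rfl
  have ha := congrArg (coeff · 0) h0
  have hb := congrArg (coeff · 1) h0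
  have hc := congrArg (coeff · 2) h0
  have r0 := key {0, 1} rfl
  have r1 := key {0, 2} rfl
  have r2 := key {0, 3} rfl
  have r3 := key {1, 2} rfl
  have r4 := key {1, 3} rfl
  have r5 := key {2, 3} rfl
  simp [elt, ofCoeffs, coeff_C, coeff_X, coeff_X_pow] at ha hb hc r0 r1 r2 r3 r4 r5
  obtain rfl : r = 0 := by
    funext i
    fin_cases i <;> assumption
  exact ⟨s, t, by rw [ha, hb, hc]⟩

set_option maxHeartbeats 2000000 in
theorem jb_even_even {p q : ℕ} (hp : Even p)
    (ε a b c : ℂ) (r : Fin 6 → ℂ) (a₂ b₂ c₂ : ℂ) (r₂ : Fin 6 → ℂ) :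
    jb p q (elt ε a b c r 0 0) (elt ε a₂ b₂ c₂ r₂ 0 0) =
      elt ε
        (a * b₂ - b * a₂)
        (2 * a * c₂ - 2 * c * a₂)
        (b * c₂ - c * b₂)
        ![
          (1 / 2) * (r 1 * r₂ 3 + r 2 * r₂ 4 - r 3 * r₂ 1 - r 4 * r₂ 2),
          (1 / 2) * (-r 0 * r₂ 3 + r 2 * r₂ 5 + r 3 * r₂ 0 - r 5 * r₂ 2),
          (1 / 2) * (-r 0 * r₂ 4 - r 1 * r₂ 5 + r 4 * r₂ 0 + r 5 * r₂ 1),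
          (1 / 2) * (r 0 * r₂ 1 - r 1 * r₂ 0 + r 4 * r₂ 5 - r 5 * r₂ 4),
          (1 / 2) * (r 0 * r₂ 2 - r 2 * r₂ 0 - r 3 * r₂ 5 + r 5 * r₂ 3),
          (1 / 2) * (r 1 * r₂ 2 - r 2 * r₂ 1 + r 3 * r₂ 4 - r 4 * r₂ 3)] 0 0 := by
  have hs : (-1 : ℂ) ^ p = 1 := hp.neg_one_pow
  have hpq : (-1 : ℂ) ^ (p * q) = 1 := (hp.mul_right q).neg_one_pow
  simp [jb, elt, hs, hpq, Fin.sum_univ_four, Dop_0_ofCoeffs, Dop_1_ofCoeffs, Dop_2_ofCoeffs,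
    Dop_3_ofCoeffs, dx_ofCoeffs]
  simp [amul_ofCoeffs, smul_ofCoeffs, ofCoeffs_add, ofCoeffs_sub]
  refine ofCoeffs_eq_of_eval fun z i => ?_
  fin_cases i <;> simp <;> ring

set_option maxHeartbeats 2000000 in
theorem jb_even_odd {p q : ℕ} (hp : Even p)
    (ε a b c : ℂ) (r : Fin 6 → ℂ) (s₂ t₂ : Fin 4 → ℂ) :
    jb p q (elt ε a b c r 0 0) (elt ε 0 0 0 0 s₂ t₂) =
      elt ε
        0 0 0 0
        ![
          (1 / 2) * (-r 0 * s₂ 1 - r 1 * s₂ 2 - r 2 * s₂ 3 + 2 * a * t₂ 0 - b * s₂ 0),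
          (1 / 2) * (r 0 * s₂ 0 - r 3 * s₂ 2 - r 4 * s₂ 3 + 2 * a * t₂ 1 - b * s₂ 1),
          (1 / 2) * (r 1 * s₂ 0 + r 3 * s₂ 1 - r 5 * s₂ 3 + 2 * a * t₂ 2 - b * s₂ 2),
          (1 / 2) * (r 2 * s₂ 0 + r 4 * s₂ 1 + r 5 * s₂ 2 + 2 * a * t₂ 3 - b * s₂ 3)]
        ![
          (1 / 2) * (-r 0 * t₂ 1 - r 1 * t₂ 2 - r 2 * t₂ 3 + b * t₂ 0 - 2 * c * s₂ 0),
          (1 / 2) * (r 0 * t₂ 0 - r 3 * t₂ 2 - r 4 * t₂ 3 + b * t₂ 1 - 2 * c * s₂ 1),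
          (1 / 2) * (r 1 * t₂ 0 + r 3 * t₂ 1 - r 5 * t₂ 3 + b * t₂ 2 - 2 * c * s₂ 2),
          (1 / 2) * (r 2 * t₂ 0 + r 4 * t₂ 1 + r 5 * t₂ 2 + b * t₂ 3 - 2 * c * s₂ 3)] := by
  have hs : (-1 : ℂ) ^ p = 1 := hp.neg_one_pow
  have hpq : (-1 : ℂ) ^ (p * q) = 1 := (hp.mul_right q).neg_one_pow
  simp [jb, elt, hs, hpq, Fin.sum_univ_four, Dop_0_ofCoeffs, Dop_1_ofCoeffs, Dop_2_ofCoeffs,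
    Dop_3_ofCoeffs, dx_ofCoeffs]
  simp [amul_ofCoeffs, smul_ofCoeffs, ofCoeffs_add, ofCoeffs_sub]
  refine ofCoeffs_eq_of_eval fun z i => ?_
  fin_cases i <;> simp <;> ring

set_option maxHeartbeats 2000000 in
theorem jb_odd_even {p q : ℕ} (hp : Odd p) (hq : Even q)
    (ε : ℂ) (s t : Fin 4 → ℂ) (a₂ b₂ c₂ : ℂ) (r₂ : Fin 6 → ℂ) :
    jb p q (elt ε 0 0 0 0 s t) (elt ε a₂ b₂ c₂ r₂ 0 0) =
      elt ε
        0 0 0 0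
        ![
          (1 / 2) * (s 0 * b₂ + s 1 * r₂ 0 + s 2 * r₂ 1 + s 3 * r₂ 2 - 2 * t 0 * a₂),
          (1 / 2) * (-s 0 * r₂ 0 + s 1 * b₂ + s 2 * r₂ 3 + s 3 * r₂ 4 - 2 * t 1 * a₂),
          (1 / 2) * (-s 0 * r₂ 1 - s 1 * r₂ 3 + s 2 * b₂ + s 3 * r₂ 5 - 2 * t 2 * a₂),
          (1 / 2) * (-s 0 * r₂ 2 - s 1 * r₂ 4 - s 2 * r₂ 5 + s 3 * b₂ - 2 * t 3 * a₂)]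
        ![
          (1 / 2) * (2 * s 0 * c₂ - t 0 * b₂ + t 1 * r₂ 0 + t 2 * r₂ 1 + t 3 * r₂ 2),
          (1 / 2) * (2 * s 1 * c₂ - t 0 * r₂ 0 - t 1 * b₂ + t 2 * r₂ 3 + t 3 * r₂ 4),
          (1 / 2) * (2 * s 2 * c₂ - t 0 * r₂ 1 - t 1 * r₂ 3 - t 2 * b₂ + t 3 * r₂ 5),
          (1 / 2) * (2 * s 3 * c₂ - t 0 * r₂ 2 - t 1 * r₂ 4 - t 2 * r₂ 5 - t 3 * b₂)] := by
  have hs : (-1 : ℂ) ^ p = -1 := hp.neg_one_pow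
  have hpq : (-1 : ℂ) ^ (p * q) = 1 := (hq.mul_left p).neg_one_pow
  simp [jb, elt, hs, hpq, Fin.sum_univ_four, Dop_0_ofCoeffs, Dop_1_ofCoeffs, Dop_2_ofCoeffs,
    Dop_3_ofCoeffs, dx_ofCoeffs]
  simp [amul_ofCoeffs, smul_ofCoeffs, neg_ofCoeffs, ofCoeffs_add, ofCoeffs_sub]
  refine ofCoeffs_eq_of_eval fun z i => ?_
  fin_cases i <;> simp <;> ring

set_option maxHeartbeats 2000000 in
theorem jb_odd_odd {p q : ℕ} (hp : Odd p) (hq : Odd q)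
    (ε : ℂ) (s t : Fin 4 → ℂ) (s₂ t₂ : Fin 4 → ℂ) :
    jb p q (elt ε 0 0 0 0 s t) (elt ε 0 0 0 0 s₂ t₂) =
      elt ε
        ((1 / 2) * (-s 0 * s₂ 0 - s 1 * s₂ 1 - s 2 * s₂ 2 - s 3 * s₂ 3))
        ((1 / 2) * (-s 0 * t₂ 0 - s 1 * t₂ 1 - s 2 * t₂ 2 - s 3 * t₂ 3 - t 0 * s₂ 0 - t 1 * s₂ 1
        - t 2 * s₂ 2 - t 3 * s₂ 3))
        ((1 / 2) * (-t 0 * t₂ 0 - t 1 * t₂ 1 - t 2 * t₂ 2 - t 3 * t₂ 3))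
        ![
          (1 / 2) * (ε * s 2 * t₂ 3 - ε * s 3 * t₂ 2 - ε * t 2 * s₂ 3 + ε * t 3 * s₂ 2 + s 0 * t₂ 1
          - s 1 * t₂ 0 - t 0 * s₂ 1 + t 1 * s₂ 0),
          (1 / 2) * (-ε * s 1 * t₂ 3 + ε * s 3 * t₂ 1 + ε * t 1 * s₂ 3 - ε * t 3 * s₂ 1 + s 0 * t₂ 2
          - s 2 * t₂ 0 - t 0 * s₂ 2 + t 2 * s₂ 0),
          (1 / 2) * (ε * s 1 * t₂ 2 - ε * s 2 * t₂ 1 - ε * t 1 * s₂ 2 + ε * t 2 * s₂ 1 + s 0 * t₂ 3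
          - s 3 * t₂ 0 - t 0 * s₂ 3 + t 3 * s₂ 0),
          (1 / 2) * (ε * s 0 * t₂ 3 - ε * s 3 * t₂ 0 - ε * t 0 * s₂ 3 + ε * t 3 * s₂ 0 + s 1 * t₂ 2
          - s 2 * t₂ 1 - t 1 * s₂ 2 + t 2 * s₂ 1),
          (1 / 2) * (-ε * s 0 * t₂ 2 + ε * s 2 * t₂ 0 + ε * t 0 * s₂ 2 - ε * t 2 * s₂ 0 + s 1 * t₂ 3
          - s 3 * t₂ 1 - t 1 * s₂ 3 + t 3 * s₂ 1),
          (1 / 2) * (ε * s 0 * t₂ 1 - ε * s 1 * t₂ 0 - ε * t 0 * s₂ 1 + ε * t 1 * s₂ 0 + s 2 * t₂ 3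
          - s 3 * t₂ 2 - t 2 * s₂ 3 + t 3 * s₂ 2)] 0 0 := by
  have hs : (-1 : ℂ) ^ p = -1 := hp.neg_one_pow
  have hpq : (-1 : ℂ) ^ (p * q) = -1 := (hp.mul hq).neg_one_pow
  simp [jb, elt, hs, hpq, Fin.sum_univ_four, Dop_0_ofCoeffs, Dop_1_ofCoeffs, Dop_2_ofCoeffs,
    Dop_3_ofCoeffs, dx_ofCoeffs]
  simp [amul_ofCoeffs, smul_ofCoeffs, neg_ofCoeffs, ofCoeffs_add]
  refine ofCoeffs_eq_of_eval fun z i => ?_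
  fin_cases i <;> simp <;> ring

/-- g is closed under the Lagrange–Jacobi bracket (stated for
parity-homogeneous elements, for which the bracket formula is defined;
this suffices by bilinearity). -/
theorem stmt18 (ε : ℂ) (f g : A) (pf pg : ℕ)
    (hf : f ∈ gSub ε) (hg : g ∈ gSub ε)
    (hpf : homog pf f) (hpg : homog pg g) :
    jb pf pg f g ∈ gSub ε := by
  rcases Nat.even_or_odd pf with hp | hp <;> rcases Nat.even_or_odd pg with hq | hq
  · obtain ⟨a, b, c, r, rfl⟩ := exists_eq_even_elt hp hf hpf
    obtain ⟨a₂, b₂, c₂, r₂, rfl⟩ := exists_eq_even_elt hq hg hpg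
    rw [jb_even_even hp]
    apply elt_mem_gSub
  · obtain ⟨a, b, c, r, rfl⟩ := exists_eq_even_elt hp hf hpf
    obtain ⟨s₂, t₂, rfl⟩ := exists_eq_odd_elt hq hg hpg
    rw [jb_even_odd hp]
    apply elt_mem_gSub
  · obtain ⟨s, t, rfl⟩ := exists_eq_odd_elt hp hf hpf
    obtain ⟨a₂, b₂, c₂, r₂, rfl⟩ := exists_eq_even_elt hq hg hpg
    rw [jb_odd_even hp hq]
    apply elt_mem_gSub
  · obtain ⟨s, t, rfl⟩ := exists_eq_odd_elt hp hf hpf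
    obtain ⟨s₂, t₂, rfl⟩ := exists_eq_odd_elt hq hg hpg
    rw [jb_odd_odd hp hq]
    apply elt_mem_gSub

end

end Stmt18
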